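/- If (a_n)_{n≥0} is a strictly increasing sequence of integers with a_0 ≥ 2 and a_{n+1} − a_n → ∞, then L({a_n : n ≥ 0}) ∪ {0} contains no infinite-dimensional linear subspace of ℓ∞. -/

import Mathlib

open Filter Topology Set ENNReal

noncomputable section

/-- The set of accumulation points of a real sequence: limits of convergent subsequences. -/
def accPts (x : ℕ → ℝ) : Set ℝ :=
  {a | ∃ φ : ℕ → ℕ, StrictMono φ ∧ Tendsto (fun k => x (φ k)) atTop (𝓝 a)}


/-- The space ℓ∞ of bounded real sequences. -/
abbrev Linf : Type := ↥(lp (fun _ : ℕ => ℝ) ∞)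

/-- Accumulation points of an element of ℓ∞. -/
def accPtsL (z : Linf) : Set ℝ := accPts (fun n => z n)

/-- A generic linear functional on the plane is injective on a given finite set. -/
lemma exists_injOn_add_mul (P : Finset (ℝ × ℝ)) :
    ∃ t : ℝ, Set.InjOn (fun p : ℝ × ℝ => p.2 + t * p.1) (P : Set (ℝ × ℝ)) := by
  obtain ⟨t, ht⟩ := Infinite.exists_notMem_finset
    ((P ×ˢ P).image fun pq => -((pq.1.2 - pq.2.2) / (pq.1.1 - pq.2.1)))
  refine ⟨t, fun p hp q hq hpq => ?_⟩
  simp only at hpq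
  have h1 : p.1 = q.1 := by
    by_contra hne
    refine ht (Finset.mem_image.2 ⟨(p, q), Finset.mem_product.2 ⟨hp, hq⟩, ?_⟩)
    have : p.1 - q.1 ≠ 0 := sub_ne_zero.2 hne
    field_simp
    linarith
  refine Prod.ext h1 ?_
  rw [h1] at hpq
  linarith

/-- Projecting a finite planar set along the direction of maximal slope it determines merges at
least two points, and loses at most as many points as the set has columns: every point that is not
the leftmost one on its line is the highest point of its column. -/
lemma exists_card_image_sub_mul (P : Finset (ℝ × ℝ))
    (hP : ∃ p ∈ P, ∃ q ∈ P, q.1 < p.1) :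
    ∃ t : ℝ, (P.image fun p => p.2 - t * p.1).card < P.card ∧
      P.card ≤ (P.image fun p => p.2 - t * p.1).card + (P.image Prod.fst).card := by
  obtain ⟨p₀, hp₀, q₀, hq₀, hlt₀⟩ := hP
  obtain ⟨⟨p, q⟩, hpq, hmax⟩ := Finset.exists_max_image
    ((P ×ˢ P).filter fun pq => pq.2.1 < pq.1.1)
    (fun pq => (pq.1.2 - pq.2.2) / (pq.1.1 - pq.2.1))
    ⟨(p₀, q₀), by simp [hp₀, hq₀, hlt₀]⟩
  simp only [Finset.mem_filter, Finset.mem_product, and_imp, Prod.forall] at hpq hmax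
  obtain ⟨⟨hp, hq⟩, hlt⟩ := hpq
  set t := (p.2 - q.2) / (p.1 - q.1) with ht
  have hslope : ∀ r ∈ P, ∀ s ∈ P, s.1 < r.1 → r.2 - t * r.1 ≤ s.2 - t * s.1 := by
    intro r hr s hs hsr
    have := hmax r.1 r.2 s.1 s.2 hr hs hsr
    rw [div_le_iff₀ (sub_pos.2 hsr)] at this
    linarith
  refine ⟨t, ?_, ?_⟩
  · refine lt_of_le_of_ne Finset.card_image_le fun h => ?_
    have hinj := Finset.card_image_iff.1 h
    have hpq' : p.2 - t * p.1 = q.2 - t * q.1 := by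
      have : p.1 - q.1 ≠ 0 := (sub_pos.2 hlt).ne'
      have h2 : t * (p.1 - q.1) = p.2 - q.2 := by rw [ht]; field_simp
      linarith
    exact hlt.ne' (congrArg Prod.fst (hinj hp hq hpq'))
  · classical
    set T := P.filter fun r => ∀ s ∈ P, s.1 = r.1 → s.2 ≤ r.2
    have hTcard : T.card ≤ (P.image Prod.fst).card := by
      refine Finset.card_le_card_of_injOn Prod.fst
        (fun r hr => Finset.mem_image_of_mem _ (Finset.mem_filter.1 hr).1) ?_
      intro r hr s hs hrs
      obtain ⟨hrP, hr⟩ := Finset.mem_filter.1 hr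
      obtain ⟨hsP, hs⟩ := Finset.mem_filter.1 hs
      exact Prod.ext hrs (le_antisymm (hs r hrP hrs) (hr s hsP hrs.symm))
    have key : ∀ r ∈ P, ∀ s ∈ P, r.2 - t * r.1 = s.2 - t * s.1 → s.1 < r.1 → r ∈ T := by
      intro r hr s hs hrs hlt
      refine Finset.mem_filter.2 ⟨hr, fun u hu hur => ?_⟩
      have := hslope u hu s hs (hur ▸ hlt)
      rw [hur] at this
      linarith
    have hrest : (P \ T).card ≤ (P.image fun p => p.2 - t * p.1).card := by
      refine Finset.card_le_card_of_injOn _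
        (fun r hr => Finset.mem_image_of_mem _ (Finset.mem_sdiff.1 hr).1) ?_
      intro r hr s hs hrs
      obtain ⟨hrP, hrT⟩ := Finset.mem_sdiff.1 hr
      obtain ⟨hsP, hsT⟩ := Finset.mem_sdiff.1 hs
      simp only at hrs
      rcases lt_trichotomy r.1 s.1 with h | h | h
      · exact absurd (key s hsP r hrP hrs.symm h) hsT
      · refine Prod.ext h ?_
        rw [h] at hrs
        linarith
      · exact absurd (key r hrP s hsP hrs h) hrT
    have hTP : T ⊆ P := Finset.filter_subset _ P
    have := Finset.card_sdiff_add_card_eq_card hTP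
    omega

section FunctionSpaces

variable {X V : Type*} [AddCommGroup V] [Module ℝ V] (E : V →ₗ[ℝ] X → ℝ)

/-- A space of finitely-valued functions with a uniform bound on the number of values is
finite-dimensional. -/
lemma finite_of_ncard_range_le (hE : Function.Injective E) (hfin : ∀ v, (range (E v)).Finite)
    (B : ℕ) (hB : ∀ v, (range (E v)).ncard ≤ B) : Module.Finite ℝ V := by
  obtain ⟨_, ⟨g, rfl⟩, hmax⟩ := (Set.finite_Iic B).subset
    (by rintro _ ⟨v, rfl⟩; exact hB v : range (fun v => (range (E v)).ncard) ⊆ Iic B)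
    |>.exists_maximal ⟨_, ⟨0, rfl⟩⟩
  have hg : ∀ v, (range (E v)).ncard ≤ (range (E g)).ncard := fun v =>
    (le_total _ _).elim id fun h => hmax ⟨v, rfl⟩ h
  have hdet : ∀ f x y, E g x = E g y → E f x = E f y := by
    intro f x y hxy
    have hP : (range fun x => (E f x, E g x)).Finite :=
      ((hfin f).prod (hfin g)).subset (by rintro _ ⟨x, rfl⟩; exact ⟨⟨x, rfl⟩, ⟨x, rfl⟩⟩)
    obtain ⟨t, ht⟩ := exists_injOn_add_mul hP.toFinset
    rw [hP.coe_toFinset] at ht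
    have hsum : (fun p : ℝ × ℝ => p.2 + t * p.1) '' (range fun x => (E f x, E g x))
        = range (E (g + t • f)) := by
      rw [← range_comp]; congr 1; ext x; simp
    have hsnd : Prod.snd '' (range fun x => (E f x, E g x)) = range (E g) := by
      rw [← range_comp]; rfl
    have hcard : (range fun x => (E f x, E g x)).ncard ≤
        (Prod.snd '' (range fun x => (E f x, E g x))).ncard := by
      rw [hsnd, ← ht.ncard_image, hsum]
      exact hg _
    have hinj := (Set.ncard_image_iff hP).1 (le_antisymm (Set.ncard_image_le hP) hcard)
    exact congrArg Prod.fst (hinj ⟨x, rfl⟩ ⟨y, rfl⟩ hxy)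
  have : Finite (range (E g)) := hfin g
  choose s hs using fun y : range (E g) => y.2
  let R : V →ₗ[ℝ] range (E g) → ℝ := LinearMap.funLeft ℝ ℝ s ∘ₗ E
  refine Module.Finite.of_injective R ((injective_iff_map_eq_zero R).2 fun v hv => ?_)
  refine (injective_iff_map_eq_zero E).1 hE v (funext fun x => ?_)
  rw [hdet v x (s ⟨E g x, x, rfl⟩) (hs ⟨E g x, x, rfl⟩).symm]
  exact congrFun hv ⟨E g x, x, rfl⟩

/-- A space of functions whose nonzero members take a number of values in a set of integers with
gaps tending to infinity is finite-dimensional. -/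
lemma finite_of_ncard_range_mem [Nonempty X] (a : ℕ → ℕ) (ha : StrictMono a) (ha0 : 2 ≤ a 0)
    (hgap : Tendsto (fun n => a (n + 1) - a n) atTop atTop)
    (h : ∀ v, v ≠ 0 → (range (E v)).Finite ∧ (range (E v)).ncard ∈ range a) :
    Module.Finite ℝ V := by
  have ha2 : ∀ k, 2 ≤ a k := fun k => ha0.trans (ha.monotone (Nat.zero_le k))
  have hzero : range (E 0) = {0} := by
    rw [map_zero]; exact range_const
  have hfin : ∀ v, (range (E v)).Finite := by
    intro v
    rcases eq_or_ne v 0 with rfl | hv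
    · rw [hzero]; exact finite_singleton 0
    · exact (h v hv).1
  have hmem : ∀ v, 2 ≤ (range (E v)).ncard → (range (E v)).ncard ∈ range a := by
    intro v hv
    rcases eq_or_ne v 0 with rfl | hv'
    · rw [hzero, ncard_singleton] at hv; omega
    · exact (h v hv').2
  have htwo : ∀ v, v ≠ 0 → 2 ≤ (range (E v)).ncard := by
    intro v hv
    obtain ⟨k, hk⟩ := (h v hv).2
    exact hk ▸ ha2 k
  have hE : Function.Injective E := by
    refine (injective_iff_map_eq_zero E).2 fun v hv => ?_
    by_contra hne
    have := htwo v hne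
    rw [hv, ← map_zero E, hzero, ncard_singleton] at this
    omega
  by_contra hinf
  have hunb : ∀ B, ∃ v, B < (range (E v)).ncard := by
    by_contra! hB
    obtain ⟨B, hB⟩ := hB
    exact hinf (finite_of_ncard_range_le E hE hfin B hB)
  obtain ⟨f, hf⟩ : ∃ f : V, f ≠ 0 := by
    by_contra! h0
    have : Subsingleton V := ⟨fun x y => (h0 x).trans (h0 y).symm⟩
    exact hinf inferInstance
  set m := (range (E f)).ncard
  obtain ⟨n, hn⟩ := (hgap.eventually_gt_atTop m).exists_forall_of_atTop
  obtain ⟨g, hg⟩ := hunb (a n)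
  have hP : (range fun x => (E f x, E g x)).Finite :=
    ((hfin f).prod (hfin g)).subset (by rintro _ ⟨x, rfl⟩; exact ⟨⟨x, rfl⟩, ⟨x, rfl⟩⟩)
  set P := hP.toFinset
  have hcomb : ∀ t : ℝ, (P.image fun p => p.2 + t * p.1).card = (range (E (g + t • f))).ncard := by
    intro t
    rw [← Set.ncard_coe_finset, Finset.coe_image, hP.coe_toFinset, ← range_comp]
    congr 2; ext x; simp
  have hfst : (P.image Prod.fst).card = m := by
    rw [← Set.ncard_coe_finset, Finset.coe_image, hP.coe_toFinset, ← range_comp]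
    rfl
  have hsnd : a n < P.card := by
    have h0 := hcomb 0
    rw [zero_smul, add_zero] at h0
    exact (h0 ▸ hg).trans_le Finset.card_image_le
  obtain ⟨k, hk⟩ : P.card ∈ range a := by
    obtain ⟨t, ht⟩ := exists_injOn_add_mul P
    have hc := hcomb t
    rw [Finset.card_image_iff.2 ht] at hc
    rw [hc]
    refine hmem _ (hc ▸ ?_)
    exact (ha2 n).trans hsnd.le
  have hcol : ∃ p ∈ P, ∃ q ∈ P, q.1 < p.1 := by
    obtain ⟨_, ⟨x, rfl⟩, _, ⟨y, rfl⟩, hxy⟩ := (Set.one_lt_ncard (hfin f)).1 (htwo f hf)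
    have hmemP : ∀ x, (E f x, E g x) ∈ P := fun x => hP.mem_toFinset.2 ⟨x, rfl⟩
    rcases lt_or_gt_of_ne hxy with hlt | hlt
    · exact ⟨_, hmemP y, _, hmemP x, hlt⟩
    · exact ⟨_, hmemP x, _, hmemP y, hlt⟩
  obtain ⟨t, hlt, hle⟩ := exists_card_image_sub_mul P hcol
  have hc := hcomb (-t)
  simp only [neg_mul, ← sub_eq_add_neg] at hc
  rw [hc] at hlt hle
  rw [hfst, ← hk] at hle
  rw [← hk] at hlt hsnd
  have hnk := ha.lt_iff_lt.1 hsnd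
  obtain ⟨j, rfl⟩ : ∃ j, k = j + 1 := ⟨k - 1, by omega⟩
  have hj := hn j (by omega)
  have hj2 := ha2 j
  obtain ⟨i, hi⟩ := hmem (g + -t • f) (by omega)
  rw [← hi] at hlt hle
  have h1 : j < i := ha.lt_iff_lt.1 (by omega)
  have h2 := ha.lt_iff_lt.1 hlt
  omega

end FunctionSpaces

/-- A bounded sequence converges along every ultrafilter. -/
lemma exists_tendsto_ultrafilter (z : Linf) (U : Ultrafilter ℕ) :
    ∃ l : ℝ, Tendsto (fun n => z n) U (𝓝 l) := by
  have hz : ((U.map fun n => z n : Ultrafilter ℝ) : Filter ℝ) ≤ 𝓟 (Metric.closedBall 0 ‖z‖) := by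
    rw [le_principal_iff, Ultrafilter.mem_coe, Ultrafilter.mem_map]
    refine univ_mem' fun n => ?_
    simpa using lp.norm_apply_le_norm ENNReal.top_ne_zero z n
  obtain ⟨l, -, hl⟩ := (isCompact_closedBall (0 : ℝ) ‖z‖).ultrafilter_le_nhds _ hz
  exact ⟨l, hl⟩

/-- The limits of a bounded sequence along the nonprincipal ultrafilters. -/
def ultrafilterLimits : Linf →ₗ[ℝ] {U : Ultrafilter ℕ // (U : Filter ℕ) ≤ atTop} → ℝ where
  toFun z U := (exists_tendsto_ultrafilter z U).choose
  map_add' z w := funext fun U => tendsto_nhds_unique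
    (exists_tendsto_ultrafilter (z + w) U).choose_spec
    ((exists_tendsto_ultrafilter z U).choose_spec.add (exists_tendsto_ultrafilter w U).choose_spec)
  map_smul' c z := funext fun U => tendsto_nhds_unique
    (exists_tendsto_ultrafilter (c • z) U).choose_spec
    ((exists_tendsto_ultrafilter z U).choose_spec.const_mul c)

lemma tendsto_ultrafilterLimits (z : Linf) (U : {U : Ultrafilter ℕ // (U : Filter ℕ) ≤ atTop}) :
    Tendsto (fun n => z n) (U : Ultrafilter ℕ) (𝓝 (ultrafilterLimits z U)) :=
  (exists_tendsto_ultrafilter z U).choose_spec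

lemma range_ultrafilterLimits (z : Linf) : range (ultrafilterLimits z) = accPtsL z := by
  ext l
  constructor
  · rintro ⟨U, rfl⟩
    have hcl : MapClusterPt (ultrafilterLimits z U) atTop (fun n => z n) :=
      (tendsto_ultrafilterLimits z U).mapClusterPt.mono U.2
    exact hcl.tendsto_subseq
  · rintro ⟨φ, hφ, hl⟩
    have hU : ((Ultrafilter.of (atTop : Filter ℕ)).map φ : Filter ℕ) ≤ atTop :=
      (Filter.map_mono (Ultrafilter.of_le atTop)).trans hφ.tendsto_atTop
    refine ⟨⟨(Ultrafilter.of atTop).map φ, hU⟩,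
      tendsto_nhds_unique (tendsto_ultrafilterLimits z _) ?_⟩
    exact tendsto_map'_iff.2 (hl.mono_left (Ultrafilter.of_le atTop))

theorem not_lineable_of_gaps_tendsto_infty (a : ℕ → ℕ) (ha : StrictMono a) (ha0 : 2 ≤ a 0)
    (hgap : Tendsto (fun n => a (n + 1) - a n) atTop atTop)
    (M : Submodule ℝ Linf)
    (hM : ∀ z ∈ M, z ≠ 0 → (accPtsL z).Finite ∧ (accPtsL z).ncard ∈ Set.range a) :
    Module.Finite ℝ M := by
  have : Nonempty {U : Ultrafilter ℕ // (U : Filter ℕ) ≤ atTop} :=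
    ⟨⟨Ultrafilter.of atTop, Ultrafilter.of_le atTop⟩⟩
  refine finite_of_ncard_range_mem (ultrafilterLimits ∘ₗ M.subtype) a ha ha0 hgap fun z hz => ?_
  have hr : range ((ultrafilterLimits ∘ₗ M.subtype) z) = accPtsL z := range_ultrafilterLimits z
  rw [hr]
  exact hM z z.2 fun h0 => hz (Subtype.ext h0)
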